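/- Let (Ω, F, (F_n)_{n≥1}, P) be a filtered probability space and let (B_n)_{n≥1} be an adapted process with values in [0, K] for some K > 0. Fix μ > 0, c > 0, α ∈ (0,1) and define g(x) = μ·(1 − exp(−c·x^α)) − x, and let ρ* be the unique positive root of g. Suppose that for every n, E[B_{n+1} − B_n | F_n] = g(B_n)/(n+1) almost surely, and E[(n·(B_{n+1} − B_n))² | F_n] ≤ C almost surely for a constant C. Then (B_n) converges almost surely, and its limit is almost surely an element of {0, ρ*}. -/

import Mathlib

open MeasureTheory ProbabilityTheory Filter

open scoped Topology NNReal

section DeterministicRecursion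

variable {b d m : ℕ → ℝ}

/-- A perturbed recursion with step sizes `1 / (n + 1)` and convergent noise cannot downcross an
interval on which its drift is nonnegative infinitely often. -/
lemma not_frequently_downcross_of_drift_nonneg
    (hrec : ∀ n, b (n + 1) = b n + d n / ((n : ℝ) + 1) + (m (n + 1) - m n))
    (hm : CauchySeq m) {G : ℝ} (hd : ∀ n, |d n| ≤ G) {x y : ℝ} (hxy : x < y)
    (hdrift : ∀ n, x < b n → b n < y → 0 ≤ d n) :
    ¬((∃ᶠ n in atTop, b n < x) ∧ ∃ᶠ n in atTop, y < b n) := by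
  rintro ⟨hlow, hhigh⟩
  have hG : 0 ≤ G := (abs_nonneg _).trans (hd 0)
  obtain ⟨N₁, hN₁⟩ := Metric.cauchySeq_iff.1 hm ((y - x) / 2) (by linarith)
  obtain ⟨N₂, hN₂⟩ := exists_nat_gt (G / ((y - x) / 2))
  set N := max N₁ N₂
  have hstep : ∀ i ≥ N, G / ((i : ℝ) + 1) < (y - x) / 2 := by
    intro i hi
    have hi' : (N₂ : ℝ) ≤ i := by exact_mod_cast (le_max_right N₁ N₂).trans hi
    rw [div_lt_iff₀ (by linarith)] at hN₂
    rw [div_lt_iff₀ (by positivity)]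
    nlinarith
  have hdiff : ∀ i ≥ N, ∀ n ≥ N, -((y - x) / 2) < m n - m i := by
    intro i hi n hn
    have := hN₁ n ((le_max_left _ _).trans hn) i ((le_max_left _ _).trans hi)
    rw [Real.dist_eq] at this
    exact (abs_lt.1 this).1
  obtain ⟨i₀, hi₀, hbi₀⟩ := frequently_atTop.1 hhigh N
  have key : ∀ n ≥ i₀, ∃ i ≥ N, y ≤ b i ∧ -(G / ((i : ℝ) + 1)) + (m n - m i) ≤ b n - b i := by
    have hself : ∀ i : ℕ, -(G / ((i : ℝ) + 1)) + (m i - m i) ≤ b i - b i := by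
      intro i
      have : 0 ≤ G / ((i : ℝ) + 1) := by positivity
      linarith
    intro n hn
    induction n, hn using Nat.le_induction with
    | base => exact ⟨i₀, hi₀, hbi₀.le, hself i₀⟩
    | succ n hn ih =>
      have hnN : N ≤ n := hi₀.trans hn
      rcases le_or_gt y (b n) with h | h
      · refine ⟨n, hnN, h, ?_⟩
        have : -(G / ((n : ℝ) + 1)) ≤ d n / ((n : ℝ) + 1) := by
          rw [← neg_div]
          gcongr
          exact (abs_le.1 (hd n)).1
        linarith [hrec n]
      · obtain ⟨i, hiN, hyi, hi⟩ := ih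
        refine ⟨i, hiN, hyi, ?_⟩
        have hx : x < b n := by linarith [hstep i hiN, hdiff i hiN n hnN]
        have : 0 ≤ d n / ((n : ℝ) + 1) := div_nonneg (hdrift n hx h) (by positivity)
        linarith [hrec n]
  obtain ⟨n, hn, hbn⟩ := frequently_atTop.1 hlow i₀
  obtain ⟨i, hiN, hyi, hi⟩ := key n hn
  linarith [hstep i hiN, hdiff i hiN n (hi₀.trans hn)]

/-- The mirror image of `not_frequently_downcross_of_drift_nonneg`. -/
lemma not_frequently_upcross_of_drift_nonpos
    (hrec : ∀ n, b (n + 1) = b n + d n / ((n : ℝ) + 1) + (m (n + 1) - m n))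
    (hm : CauchySeq m) {G : ℝ} (hd : ∀ n, |d n| ≤ G) {x y : ℝ} (hxy : x < y)
    (hdrift : ∀ n, x < b n → b n < y → d n ≤ 0) :
    ¬((∃ᶠ n in atTop, b n < x) ∧ ∃ᶠ n in atTop, y < b n) := by
  rintro ⟨hlow, hhigh⟩
  refine not_frequently_downcross_of_drift_nonneg (b := -b) (d := -d) (m := -m)
    (fun n => ?_) ?_ (G := G) (by simpa using hd) (neg_lt_neg hxy) (fun n h₁ h₂ => ?_)
    ⟨hhigh.mono fun n h => neg_lt_neg h, hlow.mono fun n h => neg_lt_neg h⟩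
  · simp only [Pi.neg_apply, hrec n]
    ring
  · exact uniformContinuous_neg.comp_cauchySeq hm
  · simp only [Pi.neg_apply, neg_lt_neg_iff] at h₁ h₂
    simpa using hdrift n h₂ h₁

/-- If the drift of a convergent recursion with convergent noise converges, its limit is zero. -/
lemma drift_limit_eq_zero
    (hrec : ∀ n, b (n + 1) = b n + d n / ((n : ℝ) + 1) + (m (n + 1) - m n))
    {l s γ : ℝ} (hb : Tendsto b atTop (𝓝 l)) (hm : Tendsto m atTop (𝓝 s))
    (hd : Tendsto d atTop (𝓝 γ)) : γ = 0 := by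
  have hH := Real.tendsto_sum_range_one_div_nat_succ_atTop
  set H : ℕ → ℝ := fun n => ∑ i ∈ Finset.range n, (1 / (i + 1) : ℝ) with hHdef
  have hsum : ∀ n, ∑ i ∈ Finset.range n, d i / ((i : ℝ) + 1) = (b n - m n) - (b 0 - m 0) := by
    intro n
    rw [← Finset.sum_range_sub (fun n => b n - m n)]
    refine Finset.sum_congr rfl fun i _ => ?_
    rw [hrec i]
    ring
  have hS : (fun n => ∑ i ∈ Finset.range n, d i / ((i : ℝ) + 1)) =o[atTop] H := by
    refine Asymptotics.IsBigO.trans_isLittleO (g := fun _ => (1 : ℝ)) ?_ ?_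
    · simp_rw [hsum]
      exact ((hb.sub hm).sub_const _).isBigO_one ℝ
    · rw [Asymptotics.isLittleO_const_left]
      exact Or.inr (tendsto_norm_atTop_atTop.comp hH)
  have hT : (fun n => ∑ i ∈ Finset.range n, (d i - γ) * (1 / ((i : ℝ) + 1))) =o[atTop] H := by
    refine Asymptotics.IsLittleO.sum_range ?_ (fun i => by positivity) hH
    have h1 : (fun n => d n - γ) =o[atTop] fun _ => (1 : ℝ) := by
      rw [Asymptotics.isLittleO_one_iff]
      simpa using hd.sub_const γ
    simpa using h1.mul_isBigO (Asymptotics.isBigO_refl (fun i : ℕ => 1 / ((i : ℝ) + 1)) atTop)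
  by_contra hγ
  have hγH : (fun n => γ * H n) =o[atTop] H := by
    refine (hS.sub hT).congr_left fun n => ?_
    rw [hHdef, Finset.mul_sum, ← Finset.sum_sub_distrib]
    refine Finset.sum_congr rfl fun i _ => ?_
    ring
  rw [Asymptotics.isLittleO_const_mul_left_iff hγ] at hγH
  exact Asymptotics.isLittleO_irrefl (hH.eventually_ne_atTop 0).frequently hγH

/-- A bounded nonnegative recursion with convergent noise, whose continuous drift is positive on
`(0, ρ)` and negative on `(ρ, ∞)`, converges to `0` or `ρ`. -/
lemma exists_tendsto_of_drift_sign {g : ℝ → ℝ} (hg : Continuous g) {ρ K : ℝ}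
    (hpos : ∀ x, 0 < x → x < ρ → 0 < g x) (hneg : ∀ x, ρ < x → g x < 0)
    (hb : ∀ n, b n ∈ Set.Icc 0 K)
    (hrec : ∀ n, b (n + 1) = b n + g (b n) / ((n : ℝ) + 1) + (m (n + 1) - m n))
    (hm : ∃ s, Tendsto m atTop (𝓝 s)) :
    ∃ l, Tendsto b atTop (𝓝 l) ∧ (l = 0 ∨ l = ρ) := by
  obtain ⟨s, hs⟩ := hm
  obtain ⟨G, hG⟩ := isCompact_Icc.exists_bound_of_continuousOn (s := Set.Icc 0 K) hg.continuousOn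
  have hd : ∀ n, |g (b n)| ≤ G := fun n => hG _ (hb n)
  have hlim : ∃ l, Tendsto b atTop (𝓝 l) := by
    refine tendsto_of_no_upcrossings dense_univ ?_
      ⟨K, eventually_map.2 (.of_forall fun n => (hb n).2)⟩
      ⟨0, eventually_map.2 (.of_forall fun n => (hb n).1)⟩
    rintro x - y - hxy ⟨hlow, hhigh⟩
    have hx : 0 < x := by
      obtain ⟨n, hn⟩ := hlow.exists
      exact (hb n).1.trans_lt hn
    rcases le_or_gt y ρ with hy | hy
    · exact not_frequently_downcross_of_drift_nonneg hrec hs.cauchySeq hd hxy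
        (fun n h₁ h₂ => (hpos _ (hx.trans h₁) (h₂.trans_le hy)).le) ⟨hlow, hhigh⟩
    · refine not_frequently_upcross_of_drift_nonpos hrec hs.cauchySeq hd (max_lt hxy hy)
        (fun n h₁ _ => (hneg _ ((le_max_right _ _).trans_lt h₁)).le)
        ⟨hlow.mono fun n h => h.trans_le (le_max_left _ _), hhigh⟩
  obtain ⟨l, hl⟩ := hlim
  refine ⟨l, hl, ?_⟩
  have hgl : g l = 0 := drift_limit_eq_zero hrec hl hs ((hg.tendsto l).comp hl)
  have hl0 : 0 ≤ l := ge_of_tendsto' hl fun n => (hb n).1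
  rcases hl0.eq_or_lt with h | h
  · exact Or.inl h.symm
  rcases lt_trichotomy l ρ with h' | h' | h'
  · exact absurd hgl (hpos l h h').ne'
  · exact Or.inr h'
  · exact absurd hgl (hneg l h').ne

end DeterministicRecursion

section DriftFunction

variable {g : ℝ → ℝ} {μ c α : ℝ}

lemma continuous_drift (hα : 0 ≤ α) (hg : ∀ x : ℝ, g x = μ * (1 - Real.exp (-c * x ^ α)) - x) :
    Continuous g := by
  rw [funext hg]
  have := Real.continuous_rpow_const hα
  fun_prop

lemma exists_drift_pos (hμ : 0 < μ) (hc : 0 < c) (hα : α ∈ Set.Ioo (0 : ℝ) 1)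
    (hg : ∀ x : ℝ, g x = μ * (1 - Real.exp (-c * x ^ α)) - x) {x : ℝ} (hx : 0 < x) :
    ∃ y, 0 < y ∧ y < x ∧ 0 < g y := by
  have hlim : Tendsto (fun y : ℝ => y ^ (1 - α)) (𝓝[>] 0) (𝓝 0) := by
    have h := (Real.continuous_rpow_const (q := 1 - α) (by linarith [hα.2])).tendsto 0
    rw [Real.zero_rpow (by linarith [hα.2])] at h
    exact h.mono_left nhdsWithin_le_nhds
  have hsmall : ∀ᶠ y : ℝ in 𝓝[>] 0, y ^ (1 - α) < μ * (c / (1 + c)) :=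
    hlim.eventually_lt_const (by positivity)
  obtain ⟨y, hy, hy0, hyx⟩ :=
    (hsmall.and (Ioo_mem_nhdsGT (show (0 : ℝ) < min x 1 by positivity))).exists
  refine ⟨y, hy0, hyx.trans_le (min_le_left _ _), ?_⟩
  have hy1 : y ≤ 1 := (hyx.trans_le (min_le_right _ _)).le
  have hyα : 0 < y ^ α := Real.rpow_pos_of_pos hy0 _
  have hyα1 : y ^ α ≤ 1 := Real.rpow_le_one hy0.le hy1 hα.1.le
  have hsplit : y = y ^ (1 - α) * y ^ α := by
    rw [← Real.rpow_add hy0]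
    simp
  have hexp : Real.exp (-c * y ^ α) ≤ 1 - c / (1 + c) * y ^ α := by
    have h1 : Real.exp (-c * y ^ α) ≤ 1 / (1 + c * y ^ α) := by
      rw [neg_mul, Real.exp_neg, ← one_div]
      exact one_div_le_one_div_of_le (by positivity) (by linarith [Real.add_one_le_exp (c * y ^ α)])
    refine h1.trans ?_
    rw [div_le_iff₀ (by positivity)]
    have : (1 - c / (1 + c) * y ^ α) * (1 + c * y ^ α) - 1
        = c ^ 2 / (1 + c) * y ^ α * (1 - y ^ α) := by
      field_simp
      ring
    have : 0 ≤ c ^ 2 / (1 + c) * y ^ α * (1 - y ^ α) :=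
      mul_nonneg (by positivity) (by linarith)
    linarith
  rw [hg]
  have h2 : y < μ * (c / (1 + c)) * y ^ α := by
    calc y = y ^ (1 - α) * y ^ α := hsplit
      _ < _ := by gcongr
  nlinarith

lemma drift_neg_of_le (hμ : 0 < μ) (hg : ∀ x : ℝ, g x = μ * (1 - Real.exp (-c * x ^ α)) - x)
    {x : ℝ} (hx : μ ≤ x) : g x < 0 := by
  rw [hg]
  nlinarith [Real.exp_pos (-c * x ^ α)]

lemma drift_pos_of_lt_root (hμ : 0 < μ) (hc : 0 < c) (hα : α ∈ Set.Ioo (0 : ℝ) 1)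
    (hg : ∀ x : ℝ, g x = μ * (1 - Real.exp (-c * x ^ α)) - x)
    {ρ : ℝ} (hρ : ∀ x : ℝ, 0 < x → g x = 0 → x = ρ) {x : ℝ} (hx : 0 < x) (hxρ : x < ρ) :
    0 < g x := by
  by_contra! h
  obtain ⟨y, hy, hyx, hgy⟩ := exists_drift_pos hμ hc hα hg hx
  obtain ⟨z, hz, hgz⟩ := intermediate_value_Icc' hyx.le
    (continuous_drift hα.1.le hg).continuousOn ⟨h, hgy.le⟩
  linarith [hρ z (hy.trans_le hz.1) hgz, hz.2]

lemma drift_neg_of_root_lt (hμ : 0 < μ) (hα : 0 ≤ α)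
    (hg : ∀ x : ℝ, g x = μ * (1 - Real.exp (-c * x ^ α)) - x)
    {ρ : ℝ} (hρ0 : 0 < ρ) (hρ : ∀ x : ℝ, 0 < x → g x = 0 → x = ρ) {x : ℝ} (hxρ : ρ < x) :
    g x < 0 := by
  by_contra! h
  obtain ⟨z, hz, hgz⟩ := intermediate_value_Icc' (le_max_left x μ)
    (continuous_drift hα hg).continuousOn ⟨(drift_neg_of_le hμ hg (le_max_right x μ)).le, h⟩
  linarith [hρ z (by linarith [hz.1]) hgz, hz.1]

end DriftFunction

section Martingale

variable {Ω : Type*} {m0 : MeasurableSpace Ω} {P : Measure Ω} {𝓕 : Filtration ℕ m0}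
  {M : ℕ → Ω → ℝ}

/-- Orthogonality of the increments of a square-integrable martingale. -/
lemma MeasureTheory.Martingale.integral_sq_succ [IsFiniteMeasure P] (hM : Martingale M 𝓕 P)
    (hL2 : ∀ n, MemLp (M n) 2 P) (n : ℕ) :
    ∫ ω, M (n + 1) ω ^ 2 ∂P = ∫ ω, M n ω ^ 2 ∂P + ∫ ω, (M (n + 1) ω - M n ω) ^ 2 ∂P := by
  have hD : MemLp (M (n + 1) - M n) 2 P := (hL2 (n + 1)).sub (hL2 n)
  have hMD : Integrable (M n * (M (n + 1) - M n)) P := (hL2 n).integrable_mul hD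
  have hcond : P[M (n + 1) - M n | 𝓕 n] =ᵐ[P] 0 := by
    filter_upwards [condExp_sub (hM.integrable (n + 1)) (hM.integrable n) (𝓕 n),
      hM.condExp_ae_eq n.le_succ, hM.condExp_ae_eq (le_refl n)] with ω h₁ h₂ h₃
    rw [h₁, Pi.sub_apply, h₂, h₃, sub_self, Pi.zero_apply]
  have hzero : ∫ ω, (M n * (M (n + 1) - M n)) ω ∂P = 0 := by
    rw [← integral_condExp (𝓕.le n)]
    refine integral_eq_zero_of_ae ?_
    filter_upwards [condExp_mul_of_stronglyMeasurable_left (hM.stronglyMeasurable n) hMD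
      (hD.integrable one_le_two), hcond] with ω h₁ h₂
    rw [h₁, Pi.mul_apply, h₂, Pi.zero_apply, mul_zero]
  have hexpand : ∀ ω, M (n + 1) ω ^ 2 =
      M n ω ^ 2 + (M (n + 1) ω - M n ω) ^ 2 + 2 * (M n * (M (n + 1) - M n)) ω := by
    intro ω
    simp only [Pi.mul_apply, Pi.sub_apply]
    ring
  simp_rw [hexpand]
  have hDint : Integrable (fun ω => (M (n + 1) ω - M n ω) ^ 2) P := hD.integrable_sq
  have hsq : Integrable (fun ω => M n ω ^ 2 + (M (n + 1) ω - M n ω) ^ 2) P :=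
    (hL2 n).integrable_sq.add hDint
  rw [integral_add hsq (hMD.const_mul 2), integral_add (hL2 n).integrable_sq hDint,
    integral_const_mul, hzero]
  ring

/-- A square-integrable martingale whose increments have summable second moments converges almost
surely. -/
lemma MeasureTheory.Martingale.exists_ae_tendsto_of_summable_sq [IsProbabilityMeasure P]
    (hM : Martingale M 𝓕 P) (hL2 : ∀ n, MemLp (M n) 2 P) {a : ℕ → ℝ} (ha : Summable a)
    (hbd : ∀ n, ∫ ω, (M (n + 1) ω - M n ω) ^ 2 ∂P ≤ a n) :
    ∀ᵐ ω ∂P, ∃ l, Tendsto (fun n => M n ω) atTop (𝓝 l) := by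
  have ha0 : ∀ n, 0 ≤ a n := fun n => (integral_nonneg fun ω => sq_nonneg _).trans (hbd n)
  have hsum : ∀ n, ∫ ω, M n ω ^ 2 ∂P ≤ ∫ ω, M 0 ω ^ 2 ∂P + ∑ i ∈ Finset.range n, a i := by
    intro n
    induction n with
    | zero => simp
    | succ n ih =>
      rw [hM.integral_sq_succ hL2, Finset.sum_range_succ]
      linarith [hbd n]
  set R : ℝ := ∫ ω, M 0 ω ^ 2 ∂P + ∑' i, a i + 1
  have hL1 : ∀ n, ∫ ω, ‖M n ω‖ ∂P ≤ R := by
    intro n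
    have hint : Integrable (fun ω => M n ω ^ 2 + 1) P :=
      (hL2 n).integrable_sq.add (integrable_const 1)
    calc ∫ ω, ‖M n ω‖ ∂P ≤ ∫ ω, (M n ω ^ 2 + 1) ∂P := by
          refine integral_mono (hM.integrable n).norm hint fun ω => ?_
          simp only [Real.norm_eq_abs]
          nlinarith [sq_nonneg (|M n ω| - 1), sq_abs (M n ω), abs_nonneg (M n ω)]
      _ = ∫ ω, M n ω ^ 2 ∂P + 1 := by
          rw [integral_add (hL2 n).integrable_sq (integrable_const 1)]
          simp
      _ ≤ R := by linarith [hsum n, ha.sum_le_tsum (Finset.range n) fun i _ => ha0 i]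
  refine hM.submartingale.exists_ae_tendsto_of_bdd (R := R.toNNReal) fun n => ?_
  rw [eLpNorm_one_eq_lintegral_enorm, ← ofReal_integral_norm_eq_lintegral_enorm (hM.integrable n)]
  exact ENNReal.ofReal_le_ofReal (hL1 n)

end Martingale

section StochasticApproximation

variable {Ω : Type*} {m0 : MeasurableSpace Ω} {P : Measure Ω} [IsProbabilityMeasure P]
  {𝓕 : Filtration ℕ m0} {B : ℕ → Ω → ℝ} {K C : ℝ} {g : ℝ → ℝ}

/-- The noise of a bounded stochastic approximation scheme: the process minus its accumulated
drift. -/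
noncomputable def approximationNoise (g : ℝ → ℝ) (B : ℕ → Ω → ℝ) (n : ℕ) (ω : Ω) : ℝ :=
  B n ω - ∑ i ∈ Finset.range n, g (B i ω) / ((i : ℝ) + 1)

lemma approximationNoise_succ_sub (n : ℕ) (ω : Ω) :
    approximationNoise g B (n + 1) ω - approximationNoise g B n ω =
      B (n + 1) ω - B n ω - g (B n ω) / ((n : ℝ) + 1) := by
  simp only [approximationNoise, Finset.sum_range_succ]
  ring

lemma stronglyAdapted_approximationNoise (hB : Adapted 𝓕 B) (hg : Continuous g) :
    StronglyAdapted 𝓕 (approximationNoise g B) := by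
  intro n
  refine ((hB n).sub (Finset.measurable_fun_sum _ fun i hi => ?_)).stronglyMeasurable
  have hi : Measurable[𝓕 n] (B i) := (hB i).mono (𝓕.mono (Finset.mem_range.1 hi).le) le_rfl
  exact (hg.measurable.comp hi).div_const _

lemma memLp_approximationNoise (hB : Adapted 𝓕 B) (hg : Continuous g)
    (hrange : ∀ n ω, B n ω ∈ Set.Icc (0 : ℝ) K) (n : ℕ) :
    MemLp (approximationNoise g B n) 2 P := by
  obtain ⟨G, hG⟩ := isCompact_Icc.exists_bound_of_continuousOn (s := Set.Icc 0 K) hg.continuousOn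
  refine MemLp.of_bound (((stronglyAdapted_approximationNoise hB hg n).mono
    (𝓕.le n)).aestronglyMeasurable) (K + ∑ i ∈ Finset.range n, G / ((i : ℝ) + 1))
    (.of_forall fun ω => (norm_sub_le _ _).trans (add_le_add ?_ (norm_sum_le_of_le _ fun i _ => ?_)))
  · rw [Real.norm_of_nonneg (hrange n ω).1]
    exact (hrange n ω).2
  · rw [norm_div, Real.norm_of_nonneg (show (0 : ℝ) ≤ i + 1 by positivity)]
    gcongr
    exact hG _ (hrange i ω)

lemma memLp_two_of_range (hB : Adapted 𝓕 B) (hrange : ∀ n ω, B n ω ∈ Set.Icc (0 : ℝ) K) (n : ℕ) :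
    MemLp (B n) 2 P := by
  refine MemLp.of_bound ((hB n).mono (𝓕.le n) le_rfl).aestronglyMeasurable K
    (.of_forall fun ω => ?_)
  rw [Real.norm_of_nonneg (hrange n ω).1]
  exact (hrange n ω).2

lemma martingale_approximationNoise (hB : Adapted 𝓕 B) (hg : Continuous g)
    (hrange : ∀ n ω, B n ω ∈ Set.Icc (0 : ℝ) K)
    (hdrift : ∀ n : ℕ, P[fun ω => B (n + 1) ω - B n ω | 𝓕 n]
        =ᵐ[P] fun ω => g (B n ω) / ((n : ℝ) + 1)) :
    Martingale (approximationNoise g B) 𝓕 P := by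
  have hL2 := memLp_approximationNoise (P := P) hB hg hrange
  refine martingale_of_condExp_sub_eq_zero_nat (stronglyAdapted_approximationNoise hB hg)
    (fun n => (hL2 n).integrable one_le_two) fun n => ?_
  have hΔ : Integrable (fun ω => B (n + 1) ω - B n ω) P :=
    ((memLp_two_of_range hB hrange (n + 1)).sub
      (memLp_two_of_range hB hrange n)).integrable one_le_two
  have hmeas : StronglyMeasurable[𝓕 n] fun ω => g (B n ω) / ((n : ℝ) + 1) :=
    ((hg.measurable.comp (hB n)).div_const _).stronglyMeasurable
  have heq : approximationNoise g B (n + 1) - approximationNoise g B n =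
      (fun ω => B (n + 1) ω - B n ω) - fun ω => g (B n ω) / ((n : ℝ) + 1) :=
    funext fun ω => approximationNoise_succ_sub n ω
  have hint : Integrable (fun ω => g (B n ω) / ((n : ℝ) + 1)) P :=
    integrable_condExp.congr (hdrift n)
  rw [heq]
  filter_upwards [condExp_sub hΔ hint (𝓕 n), hdrift n] with ω h₁ h₂
  rw [h₁, Pi.sub_apply, h₂, condExp_of_stronglyMeasurable (𝓕.le n) hmeas hint, sub_self,
    Pi.zero_apply]

lemma integral_approximationNoise_sq_le (hB : Adapted 𝓕 B) (hg : Continuous g)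
    (hrange : ∀ n ω, B n ω ∈ Set.Icc (0 : ℝ) K) {G : ℝ} (hG : ∀ x ∈ Set.Icc 0 K, |g x| ≤ G)
    (hsecond : ∀ n : ℕ, ∀ᵐ ω ∂P,
      (P[fun ω' => ((n : ℝ) * (B (n + 1) ω' - B n ω')) ^ 2 | 𝓕 n]) ω ≤ C) (n : ℕ) :
    ∫ ω, (approximationNoise g B (n + 1) ω - approximationNoise g B n ω) ^ 2 ∂P ≤
      (8 * C + 2 * K ^ 2 + 2 * G ^ 2) * (1 / ((n : ℝ) + 1) ^ 2) := by
  set X : Ω → ℝ := fun ω => ((n : ℝ) * (B (n + 1) ω - B n ω)) ^ 2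
  have hX : Integrable X P :=
    (((memLp_two_of_range hB hrange (n + 1)).sub
      (memLp_two_of_range hB hrange n)).const_mul (n : ℝ)).integrable_sq
  have hXC : ∫ ω, X ω ∂P ≤ C := by
    rw [← integral_condExp (𝓕.le n)]
    calc ∫ ω, (P[X | 𝓕 n]) ω ∂P ≤ ∫ _, C ∂P :=
          integral_mono_ae integrable_condExp (integrable_const C) (hsecond n)
      _ = C := by simp
  have hpt : ∀ ω, (approximationNoise g B (n + 1) ω - approximationNoise g B n ω) ^ 2 ≤
      (8 * X ω + (2 * K ^ 2 + 2 * G ^ 2)) * (1 / ((n : ℝ) + 1) ^ 2) := by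
    intro ω
    rw [approximationNoise_succ_sub, mul_one_div, le_div_iff₀ (by positivity)]
    have hgG : g (B n ω) ^ 2 ≤ G ^ 2 := by
      rw [← sq_abs (g _)]
      exact pow_le_pow_left₀ (abs_nonneg _) (hG _ (hrange n ω)) 2
    have hΔ : ((n : ℝ) + 1) ^ 2 * (B (n + 1) ω - B n ω) ^ 2 ≤ 4 * X ω + K ^ 2 := by
      simp only [X]
      obtain ⟨h1, h2⟩ := hrange n ω
      obtain ⟨h3, h4⟩ := hrange (n + 1) ω
      rcases Nat.eq_zero_or_pos n with rfl | hn
      · simp only [Nat.cast_zero]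
        nlinarith
      · have hn' : (1 : ℝ) ≤ n := by exact_mod_cast hn
        have : ((n : ℝ) + 1) ^ 2 ≤ 4 * (n : ℝ) ^ 2 := by nlinarith
        nlinarith [mul_le_mul_of_nonneg_right this (sq_nonneg (B (n + 1) ω - B n ω)), sq_nonneg K]
    have hscale : (B (n + 1) ω - B n ω - g (B n ω) / ((n : ℝ) + 1)) ^ 2 * ((n : ℝ) + 1) ^ 2 =
        (((n : ℝ) + 1) * (B (n + 1) ω - B n ω) - g (B n ω)) ^ 2 := by
      field_simp
    rw [hscale]
    nlinarith [sq_nonneg (((n : ℝ) + 1) * (B (n + 1) ω - B n ω) + g (B n ω))]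
  have hL2 := memLp_approximationNoise (P := P) hB hg hrange
  calc _ ≤ ∫ ω, (8 * X ω + (2 * K ^ 2 + 2 * G ^ 2)) * (1 / ((n : ℝ) + 1) ^ 2) ∂P :=
        integral_mono ((hL2 (n + 1)).sub (hL2 n)).integrable_sq
          (((hX.const_mul 8).add (integrable_const _)).mul_const _) hpt
    _ = (8 * ∫ ω, X ω ∂P + (2 * K ^ 2 + 2 * G ^ 2)) * (1 / ((n : ℝ) + 1) ^ 2) := by
        rw [integral_mul_const, integral_add (hX.const_mul 8) (integrable_const _),
          integral_const_mul]
        simp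
    _ ≤ _ := mul_le_mul_of_nonneg_right (by linarith) (by positivity)

/-- The noise of a bounded stochastic approximation scheme converges almost surely. -/
lemma exists_ae_tendsto_approximationNoise (hB : Adapted 𝓕 B) (hg : Continuous g)
    (hrange : ∀ n ω, B n ω ∈ Set.Icc (0 : ℝ) K)
    (hdrift : ∀ n : ℕ, P[fun ω => B (n + 1) ω - B n ω | 𝓕 n]
        =ᵐ[P] fun ω => g (B n ω) / ((n : ℝ) + 1))
    (hsecond : ∀ n : ℕ, ∀ᵐ ω ∂P,
      (P[fun ω' => ((n : ℝ) * (B (n + 1) ω' - B n ω')) ^ 2 | 𝓕 n]) ω ≤ C) :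
    ∀ᵐ ω ∂P, ∃ s, Tendsto (fun n => approximationNoise g B n ω) atTop (𝓝 s) := by
  obtain ⟨G, hG⟩ := isCompact_Icc.exists_bound_of_continuousOn (s := Set.Icc 0 K) hg.continuousOn
  have hsum : Summable fun n : ℕ => 1 / ((n : ℝ) + 1) ^ 2 := by
    exact_mod_cast (summable_nat_add_iff 1).2 (Real.summable_one_div_nat_pow.2 one_lt_two)
  exact (martingale_approximationNoise hB hg hrange hdrift).exists_ae_tendsto_of_summable_sq
    (memLp_approximationNoise hB hg hrange) (hsum.mul_left _)
    (integral_approximationNoise_sq_le hB hg hrange hG hsecond)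

end StochasticApproximation

/-- Stochastic approximation: if an adapted `[0,K]`-valued process `B` has drift
`E[B_{n+1} - B_n | F_n] = g(B_n)/(n+1)` with `g(x) = μ(1 - exp(-c x^α)) - x`, whose
unique positive root is `ρ*`, and the rescaled increments have uniformly bounded
conditional second moments, then `B_n` converges a.s. and its limit lies in `{0, ρ*}`. -/
theorem stochastic_approximation_limit
    {Ω : Type*} {m0 : MeasurableSpace Ω} (P : Measure Ω) [IsProbabilityMeasure P]
    (𝓕 : Filtration ℕ m0)
    (K : ℝ) (hK : 0 < K)
    (B : ℕ → Ω → ℝ) (hadapted : Adapted 𝓕 B)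
    (hrange : ∀ n ω, B n ω ∈ Set.Icc (0:ℝ) K)
    (μ c α : ℝ) (hμ : 0 < μ) (hc : 0 < c) (hα : α ∈ Set.Ioo (0:ℝ) 1)
    (g : ℝ → ℝ) (hg : ∀ x : ℝ, g x = μ * (1 - Real.exp (-c * x ^ α)) - x)
    (ρ : ℝ) (hρ_pos : 0 < ρ) (hρ_root : g ρ = 0)
    (hρ_unique : ∀ x : ℝ, 0 < x → g x = 0 → x = ρ)
    (hdrift : ∀ n : ℕ,
      P[fun ω => B (n + 1) ω - B n ω | 𝓕 n]
        =ᵐ[P] fun ω => g (B n ω) / ((n : ℝ) + 1))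
    (C : ℝ)
    (hsecond : ∀ n : ℕ,
      ∀ᵐ ω ∂P, (P[fun ω' => ((n : ℝ) * (B (n + 1) ω' - B n ω')) ^ 2 | 𝓕 n]) ω ≤ C) :
    ∀ᵐ ω ∂P, ∃ l : ℝ, Tendsto (fun n => B n ω) atTop (nhds l) ∧ (l = 0 ∨ l = ρ) := by
  have hgc : Continuous g := continuous_drift hα.1.le hg
  filter_upwards [exists_ae_tendsto_approximationNoise hadapted hgc hrange hdrift hsecond] with ω hω
  refine exists_tendsto_of_drift_sign hgc (fun x => drift_pos_of_lt_root hμ hc hα hg hρ_unique)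
    (fun x => drift_neg_of_root_lt hμ hα.1.le hg hρ_pos hρ_unique) (fun n => hrange n ω)
    (fun n => ?_) hω
  linarith [approximationNoise_succ_sub (g := g) (B := B) n ω]
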